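/- Let n ≥ 7 and let k be an integer with 2 ≤ k ≤ ⌊(n−1)/2⌋. Then for every permutation σ ∈ S_n, the induced endomorphism ⋀^k ρ(σ) of ⋀^k V_n has 1 as an eigenvalue; that is, the Specht module S^{(n−k,1^k)} is unisingular. -/

import Mathlib

open Polynomial

noncomputable section

/-- The standard representation of `S_n`: the subspace `V_n` of `ℂ^n` of vectors with
coordinate sum zero (the Specht module `S^{(n-1,1)}`). -/
def Vn (n : ℕ) : Submodule ℂ (Fin n → ℂ) :=
  LinearMap.ker (∑ i : Fin n, (LinearMap.proj i : (Fin n → ℂ) →ₗ[ℂ] ℂ))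

/-- The endomorphism `ρ(σ)` of the standard representation induced by `v ↦ v ∘ σ⁻¹`. -/
def rho {n : ℕ} (σ : Equiv.Perm (Fin n)) : Vn n →ₗ[ℂ] Vn n :=
  (LinearMap.funLeft ℂ ℂ ⇑σ⁻¹).restrict (p := Vn n) (q := Vn n) fun v hv => by
    simp only [Vn, LinearMap.mem_ker, LinearMap.sum_apply, LinearMap.proj_apply,
      LinearMap.funLeft_apply] at hv ⊢
    rw [Equiv.sum_comp σ⁻¹ v]
    exact hv

/-- The linear map functorially induced on the `k`-th exterior power `⋀[R]^k M`. -/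
def extPowMap {R M : Type*} [CommRing R] [AddCommGroup M] [Module R M] (k : ℕ)
    (f : M →ₗ[R] M) : ⋀[R]^k M →ₗ[R] ⋀[R]^k M :=
  (ExteriorAlgebra.map f).toLinearMap.restrict (p := ⋀[R]^k M) (q := ⋀[R]^k M) fun x hx => by
    have h : Submodule.map (ExteriorAlgebra.map f).toLinearMap (⋀[R]^k M) ≤ ⋀[R]^k M := by
      rw [← ExteriorAlgebra.ιMulti_span_fixedDegree, Submodule.map_span, Submodule.span_le]
      rintro y ⟨z, ⟨m, rfl⟩, rfl⟩
      exact Submodule.subset_span ⟨f ∘ m, (ExteriorAlgebra.map_apply_ιMulti f m).symm⟩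
    exact h ⟨x, hx, rfl⟩

end

theorem extPowMap_ιMulti {R M : Type*} [CommRing R] [AddCommGroup M] [Module R M] (k : ℕ)
    (f : M →ₗ[R] M) (v : Fin k → M) :
    extPowMap k f (exteriorPower.ιMulti R k v) = exteriorPower.ιMulti R k (f ∘ v) := by
  ext
  exact ExteriorAlgebra.map_apply_ιMulti f v

theorem exteriorPower_ιMulti_ne_zero {K M : Type*} [Field K] [AddCommGroup M] [Module K M]
    {k : ℕ} {v : Fin k → M} (hv : LinearIndependent K v) :
    exteriorPower.ιMulti K k v ≠ 0 := by
  have h := (exteriorPower.ιMulti_family_linearIndependent_field (n := k) hv).ne_zero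
    ⟨Finset.univ, by simp [Set.powersetCard]⟩
  set e := Set.powersetCard.ofFinEmbEquiv.symm
    (⟨Finset.univ, by simp [Set.powersetCard]⟩ : Set.powersetCard (Fin k) k)
  have he : v ∘ e = v := by
    have : (e : Fin k → Fin k) = id := by
      refine (e.strictMono.range_inj strictMono_id).1 ?_
      rw [(Finite.injective_iff_surjective.1 e.injective).range_eq, Set.range_id]
    rw [this, Function.comp_id]
  rwa [exteriorPower.ιMulti_family, he] at h

/-- The wedge of independent eigenvectors whose eigenvalues multiply to `1` is fixed. -/
theorem hasEigenvalue_extPowMap_one {K M : Type*} [Field K] [AddCommGroup M] [Module K M]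
    {k : ℕ} {f : M →ₗ[K] M} {v : Fin k → M} {c : Fin k → K} (hv : LinearIndependent K v)
    (hf : ∀ i, f (v i) = c i • v i) (hc : ∏ i, c i = 1) :
    Module.End.HasEigenvalue (extPowMap k f) (1 : K) := by
  refine Module.End.hasEigenvalue_of_hasEigenvector (x := exteriorPower.ιMulti K k v)
    ⟨?_, exteriorPower_ιMulti_ne_zero hv⟩
  rw [Module.End.mem_eigenspace_iff, extPowMap_ιMulti, one_smul]
  have : f ∘ v = fun i => c i • v i := funext hf
  rw [this, AlternatingMap.map_smul_univ, hc, one_smul]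

theorem hasEigenvalue_extPowMap_one_of_finset {K M ι : Type*} [Field K] [AddCommGroup M]
    [Module K M] {k : ℕ} {f : M →ₗ[K] M} {T : Finset ι} {v : T → M} {c : ι → K}
    (hT : T.card = k) (hv : LinearIndependent K v)
    (hf : ∀ i : T, f (v i) = c i • v i) (hc : ∏ i ∈ T, c i = 1) :
    Module.End.HasEigenvalue (extPowMap k f) (1 : K) := by
  let e := (T.equivFinOfCardEq hT).symm
  refine hasEigenvalue_extPowMap_one (v := v ∘ e) (c := fun i => c (e i))
    (hv.comp e e.injective) (fun i => hf (e i)) ?_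
  rw [e.prod_comp (fun i : T => c i), Finset.prod_coe_sort, hc]

theorem exists_subset_prod_eq_one {ι K : Type*} [DecidableEq ι] [Field K] [DecidableEq K]
    (c : ι → K) (m : ℕ) (J : Finset ι) (h0 : ∀ i ∈ J, c i ≠ 0)
    (hJ : ∀ z, {i ∈ J | c i = z}.card = {i ∈ J | c i = z⁻¹}.card)
    (hm : 2 * m + 2 ≤ J.card) :
    ∃ T ⊆ J, T.card = 2 * m ∧ ∏ i ∈ T, c i = 1 := by
  induction m generalizing J with
  | zero => exact ⟨∅, by simp⟩
  | succ m ih =>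
    obtain ⟨i, hi, j, hj, hij, hinv⟩ : ∃ i ∈ J, ∃ j ∈ J, i ≠ j ∧ c j = (c i)⁻¹ := by
      by_cases h : ∃ i ∈ J, c i ≠ (c i)⁻¹
      · obtain ⟨i, hi, hne⟩ := h
        have hpos : 0 < {j ∈ J | c j = (c i)⁻¹}.card := by
          rw [← hJ]
          exact Finset.card_pos.2 ⟨i, by simp [hi]⟩
        obtain ⟨j, hj⟩ := Finset.card_pos.1 hpos
        rw [Finset.mem_filter] at hj
        exact ⟨i, hi, j, hj.1, by rintro rfl; exact hne hj.2, hj.2⟩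
      · push Not at h
        have hmaps : ∀ i ∈ J, c i ∈ ({1, -1} : Finset K) := fun i hi => by
          have := h i hi
          have h2 : c i * c i = 1 := by
            nth_rw 2 [this]
            exact mul_inv_cancel₀ (h0 i hi)
          simpa using mul_self_eq_one_iff.1 h2
        obtain ⟨i, hi, j, hj, hij, hc⟩ := Finset.exists_ne_map_eq_of_card_lt_of_maps_to
          (by have := Finset.card_le_two (a := (1 : K)) (b := -1); omega) hmaps
        exact ⟨i, hi, j, hj, hij, by rw [← hc]; exact h i hi⟩
    have hj' : j ∈ J.erase i := Finset.mem_erase.2 ⟨hij.symm, hj⟩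
    have hcount : ∀ z, {a ∈ J | c a = z}.card = {a ∈ (J.erase i).erase j | c a = z}.card +
        ((if c j = z then 1 else 0) + if c i = z then 1 else 0) := fun z => by
      simp only [Finset.card_filter]
      rw [← Finset.sum_erase_add _ _ hi, ← Finset.sum_erase_add _ _ hj', add_assoc]
    obtain ⟨T, hT, hcard, hprod⟩ := ih ((J.erase i).erase j)
      (fun a ha => h0 a (Finset.mem_of_mem_erase (Finset.mem_of_mem_erase ha)))
      (fun z => by
        have h1 := hcount z
        have h2 := hcount z⁻¹
        rw [hJ z, h2] at h1
        have e1 : c j = z ↔ c i = z⁻¹ := by rw [hinv, inv_eq_iff_eq_inv]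
        have e2 : c j = z⁻¹ ↔ c i = z := by rw [hinv, inv_inj]
        simp only [e1, e2] at h1
        omega)
      (by
        rw [Finset.card_erase_of_mem hj', Finset.card_erase_of_mem hi]
        omega)
    have hjT : j ∉ T := fun h => (Finset.notMem_erase j _) (hT h)
    have hiT : i ∉ insert j T := by
      rw [Finset.mem_insert, not_or]
      exact ⟨hij, fun h => Finset.notMem_erase i J (Finset.mem_of_mem_erase (hT h))⟩
    refine ⟨insert i (insert j T), ?_, ?_, ?_⟩
    · refine Finset.insert_subset hi (Finset.insert_subset hj ?_)
      exact hT.trans ((Finset.erase_subset _ _).trans (Finset.erase_subset _ _))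
    · rw [Finset.card_insert_of_notMem hiT, Finset.card_insert_of_notMem hjT, hcard]
      ring
    · rw [Finset.prod_insert hiT, Finset.prod_insert hjT, hprod, hinv, mul_one,
        mul_inv_cancel₀ (h0 i hi)]

theorem exists_eigenbasis.{u, w} {K : Type u} {M : Type w} [Field K] [DecidableEq K]
    [AddCommGroup M] [Module K M]
    [FiniteDimensional K M] (f : Module.End K M) (hf : ⨆ z, f.eigenspace z = ⊤) :
    ∃ (ι : Type u) (_ : Fintype ι) (b : Module.Basis ι K M) (c : ι → K),
      (∀ i, f (b i) = c i • b i) ∧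
        ∀ z, (Finset.univ.filter fun i => c i = z).card = Module.finrank K (f.eigenspace z) := by
  have hint : DirectSum.IsInternal fun z => f.eigenspace z :=
    DirectSum.isInternal_submodule_of_iSupIndep_of_iSup_eq_top f.eigenspaces_iSupIndep hf
  let b := hint.collectedBasis fun z => Module.finBasis K (f.eigenspace z)
  let _ : Fintype (Σ z, Fin (Module.finrank K (f.eigenspace z))) :=
    FiniteDimensional.fintypeBasisIndex b
  refine ⟨_, inferInstance, b, Sigma.fst, fun i => ?_, fun z => ?_⟩
  · exact Module.End.mem_eigenspace_iff.1 (hint.collectedBasis_mem _ i)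
  · have : (Finset.univ.filter fun i : Σ z, Fin (Module.finrank K (f.eigenspace z)) => i.1 = z) =
        Finset.univ.map (Function.Embedding.sigmaMk z) := by
      ext ⟨y, a⟩
      simp only [Finset.mem_filter, Finset.mem_univ, true_and, Finset.mem_map,
        Function.Embedding.sigmaMk_apply]
      constructor
      · rintro rfl
        exact ⟨a, rfl⟩
      · rintro ⟨a, h⟩
        exact (congrArg Sigma.fst h).symm
    rw [this, Finset.card_map, Finset.card_fin]

theorem exists_finset_dvd_sum {n m : ℕ} (hn : 2 * m + 7 ≤ n) :
    ∃ S : Finset ℕ, (∀ j ∈ S, 0 < j ∧ j < n ∧ (j < 4 + m ∨ n < j + 4 + m)) ∧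
      S.card = 2 * m + 3 ∧ n ∣ ∑ j ∈ S, j := by
  induction m with
  | zero =>
    refine ⟨{1, 2, n - 3}, ?_, ?_, ?_⟩
    · simp only [Finset.mem_insert, Finset.mem_singleton]
      omega
    · rw [Finset.card_eq_three.2 ⟨1, 2, n - 3, by omega, by omega, by omega, rfl⟩]
    · rw [Finset.sum_insert, Finset.sum_pair]
      · exact ⟨1, by omega⟩
      · omega
      · simp only [Finset.mem_insert, Finset.mem_singleton]
        omega
  | succ m ih =>
    obtain ⟨S, hS, hcard, hsum⟩ := ih (by omega)
    have h1 : n - (4 + m) ∉ S := fun h => by have := hS _ h; omega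
    have h2 : 4 + m ∉ insert (n - (4 + m)) S := fun h => by
      rcases Finset.mem_insert.1 h with h | h
      · omega
      · have := hS _ h; omega
    refine ⟨insert (4 + m) (insert (n - (4 + m)) S), ?_, ?_, ?_⟩
    · intro j hj
      simp only [Finset.mem_insert] at hj
      rcases hj with rfl | rfl | hj
      · omega
      · omega
      · have := hS j hj
        omega
    · rw [Finset.card_insert_of_notMem h2, Finset.card_insert_of_notMem h1, hcard]
      ring
    · rw [Finset.sum_insert h2, Finset.sum_insert h1, ← add_assoc,
        show 4 + m + (n - (4 + m)) = n by omega]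
      exact (Nat.dvd_refl n).add hsum

theorem mem_Vn {n : ℕ} {v : Fin n → ℂ} : v ∈ Vn n ↔ ∑ i, v i = 0 := by
  simp [Vn, LinearMap.sum_apply]

theorem rho_apply {n : ℕ} (σ : Equiv.Perm (Fin n)) (v : Vn n) (i : Fin n) :
    (rho σ v : Fin n → ℂ) i = (v : Fin n → ℂ) (σ⁻¹ i) := rfl

theorem rho_mul {n : ℕ} (σ τ : Equiv.Perm (Fin n)) : rho (σ * τ) = rho σ ∘ₗ rho τ := by
  ext v i
  simp [rho_apply]

theorem rho_one {n : ℕ} : rho (1 : Equiv.Perm (Fin n)) = LinearMap.id := by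
  ext v i
  simp [rho_apply]

theorem rho_pow {n : ℕ} (σ : Equiv.Perm (Fin n)) (m : ℕ) :
    rho (σ ^ m) = (rho σ : Module.End ℂ (Vn n)) ^ m := by
  induction m with
  | zero => rw [pow_zero, pow_zero, rho_one]; rfl
  | succ m ih => rw [pow_succ, pow_succ, rho_mul, ih]; rfl

theorem finrank_Vn {n : ℕ} (hn : 0 < n) : Module.finrank ℂ (Vn n) + 1 = n := by
  have hne : (∑ i : Fin n, (LinearMap.proj i : (Fin n → ℂ) →ₗ[ℂ] ℂ)) ≠ 0 := fun h => by
    have := LinearMap.congr_fun h (Pi.single ⟨0, hn⟩ 1)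
    simp [LinearMap.sum_apply] at this
  exact (Module.Dual.finrank_ker_add_one_of_ne_zero hne).trans (Module.finrank_fin_fun ℂ)

theorem iSup_eigenspace_rho {n : ℕ} (σ : Equiv.Perm (Fin n)) :
    ⨆ z, Module.End.eigenspace (rho σ) z = ⊤ := by
  refine Module.End.IsSemisimple.iSup_eigenspace_eq_top ?_
  refine Module.End.isSemisimple_of_squarefree_aeval_eq_zero
    (p := (X ^ orderOf σ - 1 : ℂ[X])) ?_ ?_
  · exact (separable_X_pow_sub_C 1 (by exact_mod_cast (orderOf_pos σ).ne') one_ne_zero).squarefree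
  · rw [map_sub, map_pow, aeval_X, map_one, ← rho_pow, pow_orderOf_eq_one, rho_one]
    exact sub_self _

theorem rho_injective {n : ℕ} (σ : Equiv.Perm (Fin n)) : Function.Injective (rho σ) := by
  refine Function.LeftInverse.injective (g := rho σ⁻¹) fun v => ?_
  rw [← LinearMap.comp_apply, ← rho_mul, inv_mul_cancel, rho_one, LinearMap.id_apply]

theorem finrank_eigenspace_rho_le_inv {n : ℕ} (σ : Equiv.Perm (Fin n)) {z : ℂ} (hz : z ≠ 0) :
    Module.finrank ℂ (Module.End.eigenspace (rho σ) z) ≤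
      Module.finrank ℂ (Module.End.eigenspace (rho σ) z⁻¹) := by
  obtain ⟨τ, hτ⟩ := isConj_iff.1
    (Equiv.Perm.isConj_iff_cycleType_eq.2 (Equiv.Perm.cycleType_inv σ).symm)
  rw [(Submodule.equivMapOfInjective (rho τ) (rho_injective τ) _).finrank_eq]
  refine Submodule.finrank_mono ?_
  rintro _ ⟨v, hv, rfl⟩
  rw [SetLike.mem_coe, Module.End.mem_eigenspace_iff] at hv
  rw [Module.End.mem_eigenspace_iff, eq_inv_smul_iff₀ hz, ← map_smul, ← map_smul, ← hv,
    ← LinearMap.comp_apply, ← LinearMap.comp_apply, ← rho_mul, ← rho_mul]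
  have : σ * τ * σ = τ := by
    rw [mul_assoc, mul_inv_eq_iff_eq_mul.1 hτ, mul_inv_cancel_left]
  rw [this]

theorem finrank_eigenspace_rho_inv {n : ℕ} (σ : Equiv.Perm (Fin n)) (z : ℂ) :
    Module.finrank ℂ (Module.End.eigenspace (rho σ) z) =
      Module.finrank ℂ (Module.End.eigenspace (rho σ) z⁻¹) := by
  rcases eq_or_ne z 0 with rfl | hz
  · rw [inv_zero]
  · refine (finrank_eigenspace_rho_le_inv σ hz).antisymm ?_
    have := finrank_eigenspace_rho_le_inv σ (inv_ne_zero hz)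
    rwa [inv_inv] at this

/-- A permutation without nonzero fixed vector in the standard representation is transitive. -/
theorem sameCycle_of_eigenspace_rho_one_eq_bot {n : ℕ} {σ : Equiv.Perm (Fin n)}
    (h : Module.End.eigenspace (rho σ) 1 = ⊥) (x y : Fin n) : σ.SameCycle x y := by
  classical
  by_contra hxy
  let A : Finset (Fin n) := {i | σ.SameCycle x i}
  let v : Fin n → ℂ := fun i => if σ.SameCycle x i then (Aᶜ.card : ℂ) else -A.card
  have hv : v ∈ Vn n := by
    rw [mem_Vn, Finset.sum_ite, Finset.sum_const, Finset.sum_const, Finset.filter_not,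
      ← Finset.compl_eq_univ_sdiff, nsmul_eq_mul, nsmul_eq_mul]
    ring
  have hfix : (⟨v, hv⟩ : Vn n) ∈ Module.End.eigenspace (rho σ) 1 := by
    rw [Module.End.mem_eigenspace_iff, one_smul]
    ext i
    simp [rho_apply, v, Equiv.Perm.sameCycle_symm_apply_right]
  rw [h, Submodule.mem_bot] at hfix
  have hx : v x = 0 := congrFun (congrArg Subtype.val hfix) x
  have hy : y ∈ Aᶜ := by simpa [A] using hxy
  have : Aᶜ.card ≠ 0 := Finset.card_ne_zero_of_mem hy
  simp [v, Equiv.Perm.SameCycle.refl, this] at hx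

theorem exists_hasEigenvector_rho {n : ℕ} {σ : Equiv.Perm (Fin n)} {x₀ : Fin n}
    (hσ : ∀ x, σ.SameCycle x₀ x) {z : ℂ} (hz : z ^ n = 1) (hz1 : z ≠ 1) :
    ∃ v, Module.End.HasEigenvector (rho σ) z v := by
  have hz0 : z ≠ 0 := by
    rintro rfl
    rw [zero_pow (by have := x₀.pos; omega)] at hz
    exact zero_ne_one hz
  have hper : Function.minimalPeriod (σ • ·) x₀ = n := by
    have : MulAction.orbit (Subgroup.zpowers σ) x₀ = Set.univ := by
      refine Set.eq_univ_of_forall fun x => ?_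
      obtain ⟨i, hi⟩ := hσ x
      exact ⟨⟨σ ^ i, i, rfl⟩, hi⟩
    have hfin : Fintype (MulAction.orbit (Subgroup.zpowers σ) x₀) := Fintype.ofFinite _
    rw [MulAction.minimalPeriod_eq_card, ← Nat.card_eq_fintype_card, this]
    simp
  have hdvd : ∀ i j : ℤ, (σ ^ i) x₀ = (σ ^ j) x₀ → z ^ i = z ^ j := fun i j hij => by
    have h1 : (σ ^ (i - j)) • x₀ = x₀ := by
      rw [sub_eq_neg_add, zpow_add, zpow_neg, Equiv.Perm.smul_def, Equiv.Perm.mul_apply, hij,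
        ← Equiv.Perm.mul_apply, inv_mul_cancel, Equiv.Perm.one_apply]
    rw [MulAction.zpow_smul_eq_iff_minimalPeriod_dvd, hper] at h1
    obtain ⟨q, hq⟩ := h1
    rw [eq_add_of_sub_eq hq, zpow_add₀ hz0, zpow_mul, zpow_natCast, hz, one_zpow, one_mul]
  choose e he using hσ
  let v : Fin n → ℂ := fun x => (z ^ e x)⁻¹
  have hvσ : ∀ x, v (σ⁻¹ x) = z * v x := fun x => by
    have := hdvd (1 + e (σ⁻¹ x)) (e x) (by
      rw [zpow_add, zpow_one, Equiv.Perm.mul_apply, he, he, ← Equiv.Perm.mul_apply, mul_inv_cancel,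
        Equiv.Perm.one_apply])
    simp only [v]
    rw [← this, zpow_add₀ hz0, zpow_one, mul_inv, mul_inv_cancel_left₀ hz0]
  have hv : v ∈ Vn n := by
    have h1 : ∑ x, v x = z * ∑ x, v x := by
      rw [Finset.mul_sum, ← Equiv.sum_comp σ⁻¹ v]
      exact Finset.sum_congr rfl fun x _ => hvσ x
    rw [mem_Vn]
    by_contra hne
    exact hz1 (mul_right_cancel₀ hne (by rw [← h1, one_mul]))
  refine ⟨⟨v, hv⟩, Module.End.mem_eigenspace_iff.2 (Subtype.ext (funext hvσ)), fun h => ?_⟩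
  exact inv_ne_zero (zpow_ne_zero _ hz0) (congrFun (congrArg Subtype.val h) x₀)

/-- For `n ≥ 7` and `2 ≤ k ≤ ⌊(n-1)/2⌋`, every `σ ∈ S_n` has `1` as an eigenvalue on
`⋀^k V_n`; i.e. the Specht module `S^{(n-k,1^k)}` is unisingular. -/
theorem specht_hook_unisingular_low (n k : ℕ) (hn : 7 ≤ n) (hk2 : 2 ≤ k)
    (hk : k ≤ (n - 1) / 2) (σ : Equiv.Perm (Fin n)) :
    Module.End.HasEigenvalue (extPowMap k (rho σ)) (1 : ℂ) := by
  classical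
  obtain ⟨ι, _, b, c, hb, hcount⟩ := exists_eigenbasis (rho σ) (iSup_eigenspace_rho σ)
  have hsymm : ∀ z, (Finset.univ.filter fun i => c i = z).card =
      (Finset.univ.filter fun i => c i = z⁻¹).card := fun z => by
    rw [hcount, hcount, finrank_eigenspace_rho_inv]
  have hcard : Fintype.card ι + 1 = n := by
    rw [← Module.finrank_eq_card_basis b, finrank_Vn (by omega)]
  have hc0 : ∀ i, c i ≠ 0 := fun i hi => b.ne_zero i <| rho_injective σ <| by
    rw [hb, hi, zero_smul, map_zero]
  have hwedge : ∀ T : Finset ι, T.card = k → ∏ i ∈ T, c i = 1 →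
      Module.End.HasEigenvalue (extPowMap k (rho σ)) (1 : ℂ) := fun T hT hprod =>
    hasEigenvalue_extPowMap_one_of_finset hT (b.linearIndependent.comp _ Subtype.val_injective)
      (fun i => hb i) hprod
  rcases Nat.even_or_odd' k with ⟨m, rfl | rfl⟩
  · obtain ⟨T, -, hT, hprod⟩ := exists_subset_prod_eq_one c m Finset.univ (fun i _ => hc0 i)
      hsymm (by rw [Finset.card_univ]; omega)
    exact hwedge T hT hprod
  by_cases h1 : ∃ i, c i = 1
  · obtain ⟨i, hi⟩ := h1
    obtain ⟨T, hTi, hT, hprod⟩ := exists_subset_prod_eq_one c m (Finset.univ.erase i)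
      (fun i _ => hc0 i) (fun z => by
        have hz : (c i = z⁻¹) ↔ (c i = z) := by rw [hi, eq_comm, inv_eq_one, eq_comm]
        have := hsymm z
        simp only [Finset.card_filter] at this ⊢
        rw [← Finset.sum_erase_add _ _ (Finset.mem_univ i),
          ← Finset.sum_erase_add _ _ (Finset.mem_univ i)] at this
        simpa only [hz, add_left_inj] using this)
      (by rw [Finset.card_erase_of_mem (Finset.mem_univ i), Finset.card_univ]; omega)
    have hiT : i ∉ T := fun h => Finset.notMem_erase i _ (hTi h)
    exact hwedge (insert i T) (by rw [Finset.card_insert_of_notMem hiT, hT])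
      (by rw [Finset.prod_insert hiT, hi, hprod, one_mul])
  · have hbot : Module.End.eigenspace (rho σ) 1 = ⊥ := by
      rw [← Submodule.finrank_eq_zero (R := ℂ), ← hcount, Finset.card_eq_zero,
        Finset.filter_eq_empty_iff]
      exact fun i _ hi => h1 ⟨i, hi⟩
    obtain ⟨m, rfl⟩ : ∃ l, m = l + 1 := ⟨m - 1, by omega⟩
    obtain ⟨S, hS, hScard, hsum⟩ := exists_finset_dvd_sum (n := n) (m := m) (by omega)
    have hζ := Complex.isPrimitiveRoot_exp n (by omega)
    set ζ := Complex.exp (2 * Real.pi * Complex.I / n)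
    have hex : ∀ j : S, ∃ v, Module.End.HasEigenvector (rho σ) (ζ ^ (j : ℕ)) v := fun j =>
      exists_hasEigenvector_rho (x₀ := ⟨0, by omega⟩)
        (sameCycle_of_eigenspace_rho_one_eq_bot hbot _)
        (by rw [← pow_mul, mul_comm, pow_mul, hζ.pow_eq_one, one_pow])
        (hζ.pow_ne_one_of_pos_of_lt (hS j j.2).1.ne' (hS j j.2).2.1)
    choose v hv using hex
    refine hasEigenvalue_extPowMap_one_of_finset (c := fun j => ζ ^ j) (v := v) (by omega)
      (Module.End.eigenvectors_linearIndependent' (rho σ) (fun j : S => ζ ^ (j : ℕ)) ?_ v hv)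
      (fun j => (hv j).apply_eq_smul) ?_
    · exact fun i j hij => Subtype.ext (hζ.pow_inj (hS i i.2).2.1 (hS j j.2).2.1 hij)
    · rw [Finset.prod_pow_eq_pow_sum]
      exact (hζ.pow_eq_one_iff_dvd _).2 hsum
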